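/- arXiv:1109.6064 — 6 statements merged into one kernel-verified Lean document; each statement's English description precedes it below -/
import Mathlib

section
/- In a finite game, for every correlated equilibrium x and every family y of nonnegative reals y^p_{i,j} ≥ 0, the expected social welfare of x is at most the maximum deviation-adjusted social welfare: Σ_{s∈S} x_s w_s ≤ max_{s∈S} ŵ_s(y). -/
open Finset

noncomputable section

variable {N : Type} [Fintype N] [DecidableEq N]
variable {S : N → Type} [∀ p, Fintype (S p)] [∀ p, DecidableEq (S p)]

/-- Social welfare of a pure strategy profile: the sum of the players' utilities. -/
def socialWelfare (u : (p : N) → ((q : N) → S q) → ℝ) (s : (q : N) → S q) : ℝ :=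
  ∑ p, u p s

/-- A correlated distribution: a nonnegative function on pure profiles summing to one. -/
def IsCorrDist (x : ((q : N) → S q) → ℝ) : Prop :=
  (∀ s, 0 ≤ x s) ∧ ∑ s, x s = 1

/-- A correlated equilibrium. -/
def IsCE (u : (p : N) → ((q : N) → S q) → ℝ) (x : ((q : N) → S q) → ℝ) : Prop :=
  IsCorrDist x ∧ ∀ (p : N) (i j : S p),
    0 ≤ ∑ s ∈ Finset.univ.filter (fun s : (q : N) → S q => s p = i),
          (u p s - u p (Function.update s p j)) * x s

/-- A coarse correlated equilibrium. -/
def IsCCE (u : (p : N) → ((q : N) → S q) → ℝ) (x : ((q : N) → S q) → ℝ) : Prop :=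
  IsCorrDist x ∧ ∀ (p : N) (j : S p),
    0 ≤ ∑ s : (q : N) → S q, (u p s - u p (Function.update s p j)) * x s

/-- Deviation-adjusted utility of player `p` at profile `s`, given multipliers `y`. -/
def devAdjU (u : (p : N) → ((q : N) → S q) → ℝ) (y : (p : N) → S p → S p → ℝ)
    (p : N) (s : (q : N) → S q) : ℝ :=
  u p s + ∑ j : S p, y p (s p) j * (u p s - u p (Function.update s p j))

/-- Deviation-adjusted social welfare. -/
def devAdjSW (u : (p : N) → ((q : N) → S q) → ℝ) (y : (p : N) → S p → S p → ℝ)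
    (s : (q : N) → S q) : ℝ :=
  ∑ p, devAdjU u y p s

/-- Coarse deviation-adjusted utility of player `p` at profile `s`. -/
def cDevAdjU (u : (p : N) → ((q : N) → S q) → ℝ) (y : (p : N) → S p → ℝ)
    (p : N) (s : (q : N) → S q) : ℝ :=
  u p s + ∑ j : S p, y p j * (u p s - u p (Function.update s p j))

/-- Coarse deviation-adjusted social welfare. -/
def cDevAdjSW (u : (p : N) → ((q : N) → S q) → ℝ) (y : (p : N) → S p → ℝ)
    (s : (q : N) → S q) : ℝ :=
  ∑ p, cDevAdjU u y p s

/-- Weighted deviation-adjusted utility of player `p` at profile `s`. -/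
def wDevAdjU (u : (p : N) → ((q : N) → S q) → ℝ) (y : (p : N) → S p → S p → ℝ)
    (v : N → ℝ) (p : N) (s : (q : N) → S q) : ℝ :=
  v p * u p s + ∑ j : S p, y p (s p) j * (u p s - u p (Function.update s p j))

/-- Weighted deviation-adjusted social welfare. -/
def wDevAdjSW (u : (p : N) → ((q : N) → S q) → ℝ) (y : (p : N) → S p → S p → ℝ)
    (v : N → ℝ) (s : (q : N) → S q) : ℝ :=
  ∑ p, wDevAdjU u y v p s

/-- Number of players choosing action `α` under profile `s`. -/
def count {N A : Type} [Fintype N] [DecidableEq A] (s : N → A) (α : A) : ℕ :=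
  (Finset.univ.filter (fun p => s p = α)).card

/-- In a correlated equilibrium, the expected gain of a player from obeying the recommendation,
weighted by nonnegative multipliers that depend on the recommended action, is nonnegative. -/
theorem IsCE.sum_mul_deviation_nonneg {u : (p : N) → ((q : N) → S q) → ℝ}
    {x : ((q : N) → S q) → ℝ} (hx : IsCE u x) (p : N) {y : S p → S p → ℝ}
    (hy : ∀ i j, 0 ≤ y i j) :
    0 ≤ ∑ s, x s * ∑ j : S p, y (s p) j * (u p s - u p (Function.update s p j)) := by
  calc (0 : ℝ)
      ≤ ∑ j : S p, ∑ i : S p, y i j *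
          ∑ s ∈ Finset.univ.filter (fun s : (q : N) → S q => s p = i),
            (u p s - u p (Function.update s p j)) * x s :=
        Finset.sum_nonneg fun j _ => Finset.sum_nonneg fun i _ =>
          mul_nonneg (hy i j) (hx.2 p i j)
    _ = ∑ j : S p, ∑ s, x s * (y (s p) j * (u p s - u p (Function.update s p j))) := by
        refine Finset.sum_congr rfl fun j _ => ?_
        rw [← Finset.sum_fiberwise (s := Finset.univ) (g := fun s : (q : N) → S q => s p)]
        refine Finset.sum_congr rfl fun i _ => ?_
        rw [Finset.mul_sum]
        refine Finset.sum_congr rfl fun s hs => ?_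
        rw [(Finset.mem_filter.mp hs).2]
        ring
    _ = _ := by
        rw [Finset.sum_comm]
        simp only [Finset.mul_sum]

/-- The expected welfare of a correlated equilibrium is at most its expected deviation-adjusted
welfare. -/
theorem IsCE.sum_mul_socialWelfare_le {u : (p : N) → ((q : N) → S q) → ℝ}
    {x : ((q : N) → S q) → ℝ} (hx : IsCE u x) {y : (p : N) → S p → S p → ℝ}
    (hy : ∀ (p : N) (i j : S p), 0 ≤ y p i j) :
    ∑ s, x s * socialWelfare u s ≤ ∑ s, x s * devAdjSW u y s := by
  simp only [socialWelfare, devAdjSW, devAdjU, Finset.sum_add_distrib, mul_add]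
  refine le_add_of_nonneg_right ?_
  simp only [Finset.mul_sum (s := (Finset.univ : Finset N))]
  rw [Finset.sum_comm]
  exact Finset.sum_nonneg fun p _ => hx.sum_mul_deviation_nonneg p (hy p)

/-- weak duality for CE: the expected social welfare of any correlated
equilibrium is at most the maximum deviation-adjusted social welfare, for any
nonnegative multipliers `y`. -/
theorem ce_welfare_le_max_devAdjSW [∀ p, Nonempty (S p)]
    (u : (p : N) → ((q : N) → S q) → ℝ) (x : ((q : N) → S q) → ℝ)
    (y : (p : N) → S p → S p → ℝ)
    (hx : IsCE u x) (hy : ∀ (p : N) (i j : S p), 0 ≤ y p i j) :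
    ∑ s, x s * socialWelfare u s ≤
      Finset.univ.sup' Finset.univ_nonempty
        (fun s : (q : N) → S q => devAdjSW u y s) := by
  refine (hx.sum_mul_socialWelfare_le hy).trans ?_
  calc ∑ s, x s * devAdjSW u y s
      ≤ ∑ s, x s * Finset.univ.sup' Finset.univ_nonempty
          (fun s : (q : N) → S q => devAdjSW u y s) :=
        Finset.sum_le_sum fun s _ => mul_le_mul_of_nonneg_left
          (Finset.le_sup' (fun s : (q : N) → S q => devAdjSW u y s) (Finset.mem_univ s))
          (hx.1.1 s)
    _ = _ := by rw [← Finset.sum_mul, hx.1.2, one_mul]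
end
end

section
/- In a polymatrix game, the weighted deviation-adjusted utility decomposes into pairwise terms: for every family y of reals y^p_{i,j}, every family v of reals v_p, every player p, and every profile s, û^p_s(y, v) = Σ_{p'≠p} g^{pp'}(s_p, s_{p'}), where g^{pp'}(ℓ, ℓ') = v_p A^{pp'}(ℓ, ℓ') + Σ_{j∈S_p} y^p_{ℓ, j} (A^{pp'}(ℓ, ℓ') − A^{pp'}(j, ℓ')); in particular each summand depends only on the actions of p and p'. -/
open Finset

noncomputable section

variable {N : Type} [Fintype N] [DecidableEq N]
variable {S : N → Type} [∀ p, Fintype (S p)] [∀ p, DecidableEq (S p)]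

/-- in a polymatrix game, the weighted deviation-adjusted utility
decomposes into pairwise terms, each depending only on the actions of `p` and `p'`. -/
theorem wDevAdjU_polymatrix
    (A : (p p' : N) → S p → S p' → ℝ)
    (u : (p : N) → ((q : N) → S q) → ℝ)
    (hu : ∀ (p : N) (s : (q : N) → S q),
      u p s = ∑ p' ∈ Finset.univ \ {p}, A p p' (s p) (s p'))
    (y : (p : N) → S p → S p → ℝ) (v : N → ℝ)
    (p : N) (s : (q : N) → S q) :
    wDevAdjU u y v p s =
      ∑ p' ∈ Finset.univ \ {p},
        (v p * A p p' (s p) (s p') +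
          ∑ j : S p, y p (s p) j * (A p p' (s p) (s p') - A p p' j (s p'))) := by
  have hdev : ∀ j : S p, u p (Function.update s p j) =
      ∑ p' ∈ Finset.univ \ {p}, A p p' j (s p') := fun j => by
    rw [hu]
    refine Finset.sum_congr rfl fun q hq => ?_
    have hqp : q ≠ p := by simpa using hq
    rw [Function.update_self, Function.update_of_ne hqp]
  simp only [wDevAdjU, hdev, hu p s]
  rw [Finset.sum_add_distrib, Finset.sum_comm, Finset.mul_sum]
  simp only [← Finset.sum_sub_distrib, Finset.mul_sum]
end
end

section
/- For a tree polymatrix game, the dynamic program over the tree computes the optimal social welfare: suppose there is a player r and a function parent : N \ {r} → N such that the undirected graph on N with edge set {{p, parent(p)} : p ∈ N \ {r}} is a tree, and A^{pp'} = 0 whenever neither p' = parent(p) nor p = parent(p'). For each p let children(p) = {q ∈ N \ {r} : parent(q) = p}, and define W_p : S_p → ℝ by the recursion (well-founded since the graph is a tree) W_p(ℓ) = Σ_{q ∈ children(p)} max_{ℓ' ∈ S_q} ( W_q(ℓ') + A^{pq}(ℓ, ℓ') + A^{qp}(ℓ', ℓ) ). Then max_{s∈S} w_s = max_{ℓ ∈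 S_r} W_r(ℓ). -/
open Finset

noncomputable section

variable {N : Type} [Fintype N] [DecidableEq N]
variable {S : N → Type} [∀ p, Fintype (S p)] [∀ p, DecidableEq (S p)]

/-- In a connected graph whose edges are the pairs `{p, parent p}` with `p ≠ r`, passing to the
parent strictly decreases the distance to `r`. -/
theorem SimpleGraph.dist_parent_lt {V : Type*} {r : V} {parent : V → V}
    (hconn : (SimpleGraph.fromRel (fun p q : V => p ≠ r ∧ parent p = q)).Connected)
    {p : V} (hp : p ≠ r) :
    (SimpleGraph.fromRel (fun p q : V => p ≠ r ∧ parent p = q)).dist r (parent p) <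
      (SimpleGraph.fromRel (fun p q : V => p ≠ r ∧ parent p = q)).dist r p := by
  set G := SimpleGraph.fromRel (fun p q : V => p ≠ r ∧ parent p = q) with hG
  induction hn : G.dist r p using Nat.strong_induction_on generalizing p with
  | _ n ih =>
    subst hn
    obtain ⟨w, hw⟩ := hconn.exists_walk_length_eq_dist p r
    cases w with
    | nil => exact absurd rfl hp
    | @cons _ v _ hadj w =>
      have hv : G.dist r v < G.dist r p := by
        rw [G.dist_comm (u := r) (v := p), ← hw, G.dist_comm, SimpleGraph.Walk.length_cons]
        exact Nat.lt_succ_of_le (SimpleGraph.dist_le w)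
      obtain ⟨-, ⟨-, h⟩ | ⟨hvr, h⟩⟩ := (SimpleGraph.fromRel_adj _ _ _).1 hadj
      · rwa [h]
      · have := ih _ hv hvr rfl
        rw [h] at this
        exact absurd this hv.not_gt

/-- A dependent function can be defined by recursion along a parent map that decreases a rank. -/
theorem exists_eq_of_parent_rank_lt {V : Type*} {T : V → Type*} {r : V} {parent : V → V}
    (rank : V → ℕ) (hrank : ∀ p, p ≠ r → rank (parent p) < rank p)
    (x : T r) (next : ∀ q, T (parent q) → T q) :
    ∃ s : ∀ q, T q, s r = x ∧ ∀ q, q ≠ r → s q = next q (s (parent q)) := by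
  classical
  let F : ∀ p, (∀ q, rank q < rank p → T q) → T p := fun p ih =>
    if h : p = r then h ▸ x else next p (ih (parent p) (hrank p h))
  have hwf : WellFounded fun a b : V => rank a < rank b := (measure rank).wf
  refine ⟨hwf.fix F, ?_, fun q hq => ?_⟩
  · rw [hwf.fix_eq]
    simp [F]
  · rw [hwf.fix_eq]
    simp [F, hq]

/-- Summing over all parents and then over their children is summing over the non-roots. -/
theorem sum_sum_children_add {V : Type*} [Fintype V] [DecidableEq V] (r : V) (parent : V → V)
    (f : V → ℝ) :
    ∑ p, ∑ q ∈ Finset.univ.filter (fun q : V => q ≠ r ∧ parent q = p), f q + f r = ∑ p, f p := by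
  simp_rw [Finset.sum_filter]
  rw [Finset.sum_comm, ← Finset.sum_erase_add _ _ (Finset.mem_univ r)]
  rw [← Finset.sum_erase_add Finset.univ f (Finset.mem_univ r)]
  congr 1
  simp only [ne_eq, not_true_eq_false, false_and, if_false, Finset.sum_const_zero, add_zero]
  refine Finset.sum_congr rfl fun q hq => ?_
  simp [Finset.ne_of_mem_erase hq]

/-- The welfare of a polymatrix game supported on the edges `{q, parent q}` is the sum of the
payoffs along those edges. -/
theorem socialWelfare_eq_sum_children {V : Type} [Fintype V] [DecidableEq V] {T : V → Type}
    (A : (p p' : V) → T p → T p' → ℝ)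
    (u : (p : V) → ((q : V) → T q) → ℝ)
    (hu : ∀ (p : V) (s : (q : V) → T q),
      u p s = ∑ p' ∈ Finset.univ \ {p}, A p p' (s p) (s p'))
    (r : V) (parent : V → V)
    (rank : V → ℕ) (hrank : ∀ p, p ≠ r → rank (parent p) < rank p)
    (hA : ∀ p p' : V,
      ¬((p ≠ r ∧ parent p = p') ∨ (p' ≠ r ∧ parent p' = p)) →
      ∀ (ℓ : T p) (ℓ' : T p'), A p p' ℓ ℓ' = 0)
    (s : (q : V) → T q) :
    socialWelfare u s =
      ∑ p, ∑ q ∈ Finset.univ.filter (fun q : V => q ≠ r ∧ parent q = p),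
        (A p q (s p) (s q) + A q p (s q) (s p)) := by
  have hsplit : ∀ p, u p s =
      ∑ q, (if q ≠ r ∧ parent q = p then A p q (s p) (s q) else 0) +
        ∑ q, (if p ≠ r ∧ parent p = q then A p q (s p) (s q) else 0) := by
    intro p
    rw [hu, ← Finset.sum_add_distrib, ← Finset.sum_subset (Finset.subset_univ (Finset.univ \ {p}))]
    · refine Finset.sum_congr rfl fun q _ => ?_
      by_cases h₁ : q ≠ r ∧ parent q = p
      · have h₂ : ¬(p ≠ r ∧ parent p = q) := by
          rintro ⟨hp, hpq⟩
          have h := hrank p hp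
          have h' := hrank q h₁.1
          rw [hpq] at h
          rw [h₁.2] at h'
          exact h.not_gt h'
        rw [if_pos h₁, if_neg h₂, add_zero]
      · by_cases h₂ : p ≠ r ∧ parent p = q
        · rw [if_neg h₁, if_pos h₂, zero_add]
        · rw [if_neg h₁, if_neg h₂, add_zero]
          exact hA p q (not_or.2 ⟨h₂, h₁⟩) _ _
    · intro q _ hq
      obtain rfl : q = p := by simpa using hq
      have h : ¬(q ≠ r ∧ parent q = q) := fun h => by
        have := hrank q h.1
        rw [h.2] at this
        exact this.false
      rw [if_neg h, add_zero]
  simp_rw [socialWelfare, hsplit, Finset.sum_add_distrib, Finset.sum_filter]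
  rw [Finset.sum_comm (f := fun p q => if p ≠ r ∧ parent p = q then A p q (s p) (s q) else 0)]

/-- in a tree polymatrix game (the graph with an edge between each
non-root player and its parent is a tree, and `A^{pp'} = 0` on non-edges), any
function `W` satisfying the bottom-up dynamic-programming recursion computes the
optimal social welfare: `max_s w_s = max_{ℓ ∈ S_r} W_r(ℓ)`. -/
theorem tree_polymatrix_dp_optimal_welfare [∀ p, Nonempty (S p)]
    (A : (p p' : N) → S p → S p' → ℝ)
    (u : (p : N) → ((q : N) → S q) → ℝ)
    (hu : ∀ (p : N) (s : (q : N) → S q),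
      u p s = ∑ p' ∈ Finset.univ \ {p}, A p p' (s p) (s p'))
    (r : N) (parent : N → N)
    (htree : (SimpleGraph.fromRel (fun p q : N => p ≠ r ∧ parent p = q)).IsTree)
    (hA : ∀ p p' : N,
      ¬((p ≠ r ∧ parent p = p') ∨ (p' ≠ r ∧ parent p' = p)) →
      ∀ (ℓ : S p) (ℓ' : S p'), A p p' ℓ ℓ' = 0)
    (W : (p : N) → S p → ℝ)
    (hW : ∀ (p : N) (ℓ : S p),
      W p ℓ = ∑ q ∈ Finset.univ.filter (fun q : N => q ≠ r ∧ parent q = p),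
        Finset.univ.sup' Finset.univ_nonempty
          (fun ℓ' : S q => W q ℓ' + A p q ℓ ℓ' + A q p ℓ' ℓ)) :
    Finset.univ.sup' Finset.univ_nonempty
        (fun s : (q : N) → S q => socialWelfare u s) =
      Finset.univ.sup' Finset.univ_nonempty (fun ℓ : S r => W r ℓ) := by
  have hrank := fun p (hp : p ≠ r) => SimpleGraph.dist_parent_lt htree.connected hp
  have hw := socialWelfare_eq_sum_children A u hu r parent _ hrank hA
  apply le_antisymm
  · refine Finset.sup'_le _ _ fun s _ => ?_
    refine le_trans ?_ (Finset.le_sup' (fun ℓ : S r => W r ℓ) (Finset.mem_univ (s r)))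
    have hle : ∑ p, ∑ q ∈ Finset.univ.filter (fun q : N => q ≠ r ∧ parent q = p),
        (W q (s q) + (A p q (s p) (s q) + A q p (s q) (s p))) ≤ ∑ p, W p (s p) := by
      refine Finset.sum_le_sum fun p _ => ?_
      rw [hW p]
      refine Finset.sum_le_sum fun q _ => ?_
      rw [← add_assoc]
      exact Finset.le_sup' (fun ℓ' : S q => W q ℓ' + A p q (s p) ℓ' + A q p ℓ' (s p))
        (Finset.mem_univ (s q))
    simp_rw [Finset.sum_add_distrib (f := fun q => W q (s q))] at hle
    rw [Finset.sum_add_distrib, ← hw, ← sum_sum_children_add r parent fun p => W p (s p)] at hle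
    linarith
  · obtain ⟨x, -, hx⟩ := Finset.exists_mem_eq_sup' Finset.univ_nonempty (fun ℓ : S r => W r ℓ)
    have hbest : ∀ (q : N) (ℓ : S (parent q)), ∃ m : S q,
        Finset.univ.sup' Finset.univ_nonempty
          (fun ℓ' : S q => W q ℓ' + A (parent q) q ℓ ℓ' + A q (parent q) ℓ' ℓ) =
        W q m + A (parent q) q ℓ m + A q (parent q) m ℓ := fun q ℓ => by
      obtain ⟨m, -, hm⟩ := Finset.exists_mem_eq_sup' Finset.univ_nonempty
        (fun ℓ' : S q => W q ℓ' + A (parent q) q ℓ ℓ' + A q (parent q) ℓ' ℓ)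
      exact ⟨m, hm⟩
    choose best hbest using hbest
    obtain ⟨s, hsr, hs⟩ := exists_eq_of_parent_rank_lt _ hrank x best
    rw [hx, ← hsr]
    refine le_trans ?_ (Finset.le_sup' (fun s => socialWelfare u s) (Finset.mem_univ s))
    have heq : ∑ p, W p (s p) =
        ∑ p, ∑ q ∈ Finset.univ.filter (fun q : N => q ≠ r ∧ parent q = p),
          (W q (s q) + (A p q (s p) (s q) + A q p (s q) (s p))) := by
      refine Finset.sum_congr rfl fun p _ => ?_
      rw [hW p]
      refine Finset.sum_congr rfl fun q hq => ?_
      obtain ⟨hqr, rfl⟩ := (Finset.mem_filter.1 hq).2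
      rw [hbest, ← hs q hqr, add_assoc]
    simp_rw [Finset.sum_add_distrib (f := fun q => W q (s q))] at heq
    rw [Finset.sum_add_distrib, ← hw, ← sum_sum_children_add r parent fun p => W p (s p)] at heq
    linarith
end
end

section
/- In a singleton congestion game with n players, for any player-symmetric family y (i.e., y^p_j = y_j for all players p and all j ∈ A) and any pure strategy profile s, the coarse deviation-adjusted social welfare decomposes over actions as w̃_s(y) = Σ_{α∈A} [ c_s(α) · f^α(c_s(α)) · (1 + Σ_{j∈A, j≠α} y_j) − (n − c_s(α)) · f^α(c_s(α) + 1) · y_α ]. -/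
open Finset

noncomputable section

variable {N : Type} [Fintype N] [DecidableEq N]
variable {S : N → Type} [∀ p, Fintype (S p)] [∀ p, DecidableEq (S p)]

/-- A player moving to an action other than the current one raises its count by one. -/
lemma count_update_of_ne {N A : Type} [Fintype N] [DecidableEq N] [DecidableEq A]
    (s : N → A) (p : N) (j : A) (h : j ≠ s p) :
    count (Function.update s p j) j = count s j + 1 := by
  have hset : Finset.univ.filter (fun q => Function.update s p j q = j) =
      insert p (Finset.univ.filter (fun q => s q = j)) := by
    ext q
    by_cases hq : q = p
    · subst hq; simp
    · simp [hq]
  unfold count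
  rw [hset, Finset.card_insert_of_notMem (by simpa using h.symm)]

/-- A sum over players of a function of their action, grouped by action. -/
lemma sum_comp_eq_sum_count_mul {N A : Type} [Fintype N] [Fintype A] [DecidableEq A]
    (s : N → A) (g : A → ℝ) :
    ∑ p, g (s p) = ∑ α, (count s α : ℝ) * g α := by
  rw [← Finset.sum_fiberwise Finset.univ s (fun p => g (s p))]
  refine Finset.sum_congr rfl fun α _ => ?_
  rw [Finset.sum_congr rfl (g := fun _ => g α) fun p hp => by rw [(Finset.mem_filter.1 hp).2]]
  simp [count]

/-- A constant summed over the players not choosing `α`. -/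
lemma sum_ite_eq_card_sub_count_mul {N A : Type} [Fintype N] [DecidableEq A]
    (s : N → A) (α : A) (K : ℝ) :
    ∑ p, (if s p = α then 0 else K) = ((Fintype.card N : ℝ) - (count s α : ℝ)) * K := by
  have h : ∀ p, (if s p = α then 0 else K) = K - (if s p = α then K else 0) := by
    intro p; split_ifs <;> simp
  simp only [h, Finset.sum_sub_distrib, ← Finset.sum_filter]
  simp [count, sub_mul]

/-- in a singleton congestion game with `n` players, for a
player-symmetric deviation vector `y`, the coarse deviation-adjusted social welfare
decomposes over actions. -/
theorem singleton_congestion_cDevAdjSW {A : Type} [Fintype A] [DecidableEq A]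
    (f : A → ℕ → ℝ)
    (u : N → (N → A) → ℝ)
    (hu : ∀ (p : N) (s : N → A), u p s = f (s p) (count s (s p)))
    (Y : N → A → ℝ) (y : A → ℝ) (hY : ∀ (p : N) (j : A), Y p j = y j)
    (s : N → A) :
    cDevAdjSW u Y s =
      ∑ α : A,
        ((count s α : ℝ) * f α (count s α) * (1 + ∑ j ∈ Finset.univ \ {α}, y j) -
          ((Fintype.card N : ℝ) - (count s α : ℝ)) * f α (count s α + 1) * y α) := by
  have hp : ∀ p, cDevAdjU u Y p s =
      f (s p) (count s (s p)) * (1 + ∑ j ∈ Finset.univ \ {s p}, y j) -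
        ∑ j, (if s p = j then 0 else f j (count s j + 1) * y j) := by
    intro p
    have hy : ∑ j ∈ Finset.univ \ {s p}, y j = ∑ j, (if s p = j then 0 else y j) := by
      rw [Finset.sum_ite, Finset.sum_const_zero, zero_add]
      refine Finset.sum_congr ?_ fun _ _ => rfl
      ext j
      simp [eq_comm]
    rw [hy, mul_add, mul_one, Finset.mul_sum, add_sub_assoc, ← Finset.sum_sub_distrib]
    unfold cDevAdjU
    rw [hu p s]
    congr 1
    refine Finset.sum_congr rfl fun j _ => ?_
    rw [hu p (Function.update s p j), hY, Function.update_self]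
    by_cases h : s p = j
    · subst h
      simp
    · rw [count_update_of_ne s p j (Ne.symm h), if_neg h, if_neg h]
      ring
  unfold cDevAdjSW
  rw [Finset.sum_congr rfl fun p _ => hp p, Finset.sum_sub_distrib, Finset.sum_comm (s := Finset.univ),
    sum_comp_eq_sum_count_mul s
      (fun α => f α (count s α) * (1 + ∑ j ∈ Finset.univ \ {α}, y j)),
    ← Finset.sum_sub_distrib]
  refine Finset.sum_congr rfl fun α _ => ?_
  rw [sum_ite_eq_card_sub_count_mul]
  ring
end
end

section
/- In a finite symmetric game, the coarse deviation-adjusted social welfare with a player-symmetric deviation vector is invariant under permuting the strategy profile: if y is player-symmetric (y^p_j = y_j for all players p and actions j ∈ A), then for every permutation π of N and every profile s, w̃_{s ∘ π}(y) = w̃_s(y), where (s ∘ π)_q = s_{π(q)}. -/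
open Finset

noncomputable section

variable {N : Type} [Fintype N] [DecidableEq N]
variable {S : N → Type} [∀ p, Fintype (S p)] [∀ p, DecidableEq (S p)]

/-- In a symmetric game, permuting the profile by `π` turns the utility of `p` into that of
`π p`. -/
lemma symmetric_utility_comp_perm {N A : Type} (u : N → (N → A) → ℝ)
    (hsym : ∀ (π : Equiv.Perm N) (p : N) (s : N → A),
      u (π p) (fun q => s (π.symm q)) = u p s)
    (π : Equiv.Perm N) (p : N) (s : N → A) :
    u p (fun q => s (π q)) = u (π p) s := by
  simpa using (hsym π p (fun q => s (π q))).symm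

/-- in a finite symmetric game, the coarse deviation-adjusted social
welfare with a player-symmetric deviation vector is invariant under permuting the
strategy profile. -/
theorem cDevAdjSW_perm_invariant {A : Type} [Fintype A] [DecidableEq A]
    (u : N → (N → A) → ℝ)
    (hsym : ∀ (π : Equiv.Perm N) (p : N) (s : N → A),
      u (π p) (fun q => s (π.symm q)) = u p s)
    (Y : N → A → ℝ) (y : A → ℝ) (hY : ∀ (p : N) (j : A), Y p j = y j)
    (π : Equiv.Perm N) (s : N → A) :
    cDevAdjSW u Y (fun q => s (π q)) = cDevAdjSW u Y s := by
  have hupd (p : N) (j : A) :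
      Function.update (fun q => s (π q)) p j = fun q => Function.update s (π p) j (π q) := by
    funext q
    simp [Function.update_apply]
  have hU (p : N) : cDevAdjU u Y p (fun q => s (π q)) = cDevAdjU u Y (π p) s := by
    simp only [cDevAdjU, hupd, symmetric_utility_comp_perm u hsym, hY]
  simp only [cDevAdjSW, hU]
  exact Equiv.sum_comp π fun p => cDevAdjU u Y p s
end
end

section
/- Weak duality for the max-min welfare CE problem: in a finite game, for every correlated equilibrium x, every family y of nonnegative reals y^p_{i,j} ≥ 0, and every family v of nonnegative reals v_p ≥ 0 with Σ_{p∈N} v_p = 1, the worst-off player's expected utility is bounded by the maximum weighted deviation-adjusted social welfare: min_{p∈N} Σ_{s∈S} x_s u^p_s ≤ max_{s∈S} ŵ_s(y, v). -/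
open Finset

noncomputable section

variable {N : Type} [Fintype N] [DecidableEq N]
variable {S : N → Type} [∀ p, Fintype (S p)] [∀ p, DecidableEq (S p)]

/-- A convex combination of finitely many reals is at least their minimum. -/
theorem inf'_le_sum_mul {ι : Type*} (t : Finset ι) (ht : t.Nonempty) (w f : ι → ℝ)
    (hw0 : ∀ i ∈ t, 0 ≤ w i) (hw1 : ∑ i ∈ t, w i = 1) :
    t.inf' ht f ≤ ∑ i ∈ t, w i * f i :=
  calc t.inf' ht f = ∑ i ∈ t, w i * t.inf' ht f := by rw [← Finset.sum_mul, hw1, one_mul]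
    _ ≤ ∑ i ∈ t, w i * f i := Finset.sum_le_sum fun i hi =>
        mul_le_mul_of_nonneg_left (Finset.inf'_le f hi) (hw0 i hi)

/-- A convex combination of finitely many reals is at most their maximum. -/
theorem sum_mul_le_sup' {ι : Type*} (t : Finset ι) (ht : t.Nonempty) (w f : ι → ℝ)
    (hw0 : ∀ i ∈ t, 0 ≤ w i) (hw1 : ∑ i ∈ t, w i = 1) :
    ∑ i ∈ t, w i * f i ≤ t.sup' ht f :=
  calc ∑ i ∈ t, w i * f i ≤ ∑ i ∈ t, w i * t.sup' ht f := Finset.sum_le_sum fun i hi =>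
        mul_le_mul_of_nonneg_left (Finset.le_sup' f hi) (hw0 i hi)
    _ = t.sup' ht f := by rw [← Finset.sum_mul, hw1, one_mul]

/-- In a correlated equilibrium, the expected deviation adjustment of each player is nonnegative. -/
theorem IsCE.expected_adjustment_nonneg {u : (p : N) → ((q : N) → S q) → ℝ}
    {x : ((q : N) → S q) → ℝ} (hx : IsCE u x) {p : N} {y : S p → S p → ℝ}
    (hy : ∀ i j, 0 ≤ y i j) :
    0 ≤ ∑ s, x s * ∑ j : S p, y (s p) j * (u p s - u p (Function.update s p j)) := by
  rw [← Finset.sum_fiberwise (g := fun s : (q : N) → S q => s p)]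
  refine Finset.sum_nonneg fun i _ => ?_
  have h : ∑ s : (q : N) → S q with s p = i,
        x s * ∑ j : S p, y (s p) j * (u p s - u p (Function.update s p j)) =
      ∑ j : S p, y i j * ∑ s : (q : N) → S q with s p = i,
        (u p s - u p (Function.update s p j)) * x s := by
    simp_rw [Finset.mul_sum]
    rw [Finset.sum_comm]
    refine Finset.sum_congr rfl fun j _ => Finset.sum_congr rfl fun s hs => ?_
    rw [(Finset.mem_filter.mp hs).2]
    ring
  rw [h]
  exact Finset.sum_nonneg fun j _ => mul_nonneg (hy i j) (hx.2 p i j)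

/-- In a correlated equilibrium, deviation adjustments do not lower the expected weighted
welfare. -/
theorem IsCE.sum_weight_mul_le {u : (p : N) → ((q : N) → S q) → ℝ}
    {x : ((q : N) → S q) → ℝ} (hx : IsCE u x) {y : (p : N) → S p → S p → ℝ}
    (hy : ∀ (p : N) (i j : S p), 0 ≤ y p i j) (v : N → ℝ) :
    ∑ p, v p * ∑ s, x s * u p s ≤ ∑ s, x s * wDevAdjSW u y v s := by
  simp only [wDevAdjSW, Finset.mul_sum]
  refine (Finset.sum_le_sum fun p _ => ?_).trans_eq Finset.sum_comm
  simp only [wDevAdjU, mul_add, Finset.sum_add_distrib, mul_left_comm (v p)]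
  exact le_add_of_nonneg_right (hx.expected_adjustment_nonneg (hy p))

/-- weak duality for the max-min welfare CE problem: the worst-off
player's expected utility under any correlated equilibrium is at most the maximum
weighted deviation-adjusted social welfare, for any nonnegative `y` and any
nonnegative weights `v` summing to one. -/
theorem maxmin_ce_weak_duality [Nonempty N] [∀ p, Nonempty (S p)]
    (u : (p : N) → ((q : N) → S q) → ℝ) (x : ((q : N) → S q) → ℝ)
    (hx : IsCE u x)
    (y : (p : N) → S p → S p → ℝ) (hy : ∀ (p : N) (i j : S p), 0 ≤ y p i j)
    (v : N → ℝ) (hv0 : ∀ p, 0 ≤ v p) (hv1 : ∑ p, v p = 1) :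
    Finset.univ.inf' Finset.univ_nonempty (fun p : N => ∑ s, x s * u p s) ≤
      Finset.univ.sup' Finset.univ_nonempty
        (fun s : (q : N) → S q => wDevAdjSW u y v s) :=
  (inf'_le_sum_mul _ _ v _ (fun p _ => hv0 p) hv1).trans <|
    (hx.sum_weight_mul_le hy v).trans <|
      sum_mul_le_sup' _ _ x _ (fun s _ => hx.1.1 s) hx.1.2
end
end
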